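/- arXiv:q-alg/9509013 — 5 statements merged into one kernel-verified Lean document; each statement's English description precedes it below -/
import Mathlib

section
/- Let 0 < q < 1 be real and let z be a complex number with z ≠ q^{-k} for every integer k ≥ 0. Then the q-exponential e_q(z) admits the partial-fraction expansion e_q(z) = 1/(z;q)_∞ = (1/(q;q)_∞) · ∑_{k=0}^∞ (−1)^k q^{k(k+1)/2} / ((q;q)_k (1 − z q^k)), the series on the right converging absolutely. -/
/-- The finite q-Pochhammer symbol `(a;q)_n = ∏_{j=0}^{n-1} (1 - a q^j)`. -/
noncomputable def qPochC (a q : ℂ) (n : ℕ) : ℂ := ∏ j ∈ Finset.range n, (1 - a * q ^ j)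

/-- The infinite q-Pochhammer symbol `(a;q)_∞ = ∏_{j=0}^{∞} (1 - a q^j)`. -/
noncomputable def qPochInfC (a q : ℂ) : ℂ := ∏' j : ℕ, (1 - a * q ^ j)

/-- The q-exponential `e_q(z) = 1/(z;q)_∞`. -/
noncomputable def qExpC (q z : ℂ) : ℂ := 1 / qPochInfC z q

lemma qaux_succ (a q : ℂ) (n : ℕ) : qPochC a q (n+1) = qPochC a q n * (1 - a * q ^ n) := by
  simp [qPochC, Finset.prod_range_succ]

lemma qaux_succ' (a q : ℂ) (n : ℕ) : qPochC a q (n+1) = (1 - a) * qPochC (a * q) q n := by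
  simp [qPochC, Finset.prod_range_succ', pow_succ', mul_assoc, mul_comm]

lemma qaux_ne (a q : ℂ) (h : ∀ k : ℕ, 1 - a * q ^ k ≠ 0) (n : ℕ) : qPochC a q n ≠ 0 :=
  Finset.prod_ne_zero_iff.mpr fun k _ => h k

noncomputable def qA (q : ℂ) (k : ℕ) : ℂ := (-1 : ℂ) ^ k * q ^ (k * (k + 1) / 2) / qPochC q q k

lemma qA_succ (q : ℂ) (h : ∀ k : ℕ, 1 - q * q ^ k ≠ 0) (k : ℕ) :
    qA q (k+1) * (1 - q ^ (k+1)) = - q ^ (k+1) * qA q k := by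
  have h1 : (k + 1) * (k + 1 + 1) / 2 = k * (k + 1) / 2 + (k + 1) := by
    rw [show (k + 1) * (k + 1 + 1) = k * (k + 1) + (k + 1) * 2 by ring]
    rw [Nat.add_mul_div_right _ _ (by norm_num)]
  have h2 := h k
  have h3 := qaux_ne q q h k
  have h4 : 1 - q ^ (k+1) ≠ 0 := by rwa [pow_succ']
  unfold qA
  rw [h1, qaux_succ, ← pow_succ']
  generalize k * (k + 1) / 2 = m
  rw [pow_add q m]
  field_simp
  ring

lemma qB_succ (q : ℂ) (h : ∀ k : ℕ, 1 - q * q ^ k ≠ 0) (k : ℕ) :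
    (qPochC q q (k+1))⁻¹ * (1 - q ^ (k+1)) = (qPochC q q k)⁻¹ := by
  have h3 := qaux_ne q q h k
  have h4 : 1 - q ^ (k+1) ≠ 0 := by have := h k; rwa [pow_succ']
  rw [qaux_succ, ← pow_succ']
  field_simp

lemma qfinite (q : ℂ) (h : ∀ k : ℕ, 1 - q * q ^ k ≠ 0) (n : ℕ) : ∀ z : ℂ,
    (∀ k : ℕ, 1 - z * q ^ k ≠ 0) →
    (qPochC z q (n+1))⁻¹ = ∑ p ∈ Finset.HasAntidiagonal.antidiagonal n,
      qA q p.1 * (qPochC q q p.2)⁻¹ * (1 - z * q ^ p.1)⁻¹ := by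
  induction n with
  | zero => intro z hz; simp [qPochC, qA]
  | succ n ih =>
    intro z hz
    have hz' : ∀ k : ℕ, 1 - (z * q) * q ^ k ≠ 0 := fun k => by
      have := hz (k+1); rwa [pow_succ', ← mul_assoc] at this
    have h4 : 1 - q ^ (n+1) ≠ 0 := by have := h n; rwa [pow_succ']
    have e1 := ih z hz
    have e2 := ih (z * q) hz'
    have key : (1 - q ^ (n+1)) * (qPochC z q (n+1+1))⁻¹ =
        (qPochC z q (n+1))⁻¹ - q ^ (n+1) * (qPochC (z*q) q (n+1))⁻¹ := by
      have a1 := qaux_succ z q (n+1)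
      have a2 := qaux_succ' z q (n+1)
      have n1 := qaux_ne z q hz (n+1)
      have n2 := qaux_ne (z*q) q hz' (n+1)
      have n3 := qaux_ne z q hz (n+1+1)
      have n4 := hz (n+1)
      have n5 : 1 - z ≠ 0 := by simpa using hz 0
      have b1 : (qPochC z q (n+1))⁻¹ = (1 - z * q^(n+1)) * (qPochC z q (n+1+1))⁻¹ := by
        rw [a1]; field_simp
      have b2 : (qPochC (z*q) q (n+1))⁻¹ = (1 - z) * (qPochC z q (n+1+1))⁻¹ := by
        rw [a2]; field_simp
      rw [b1, b2]; ring
    apply mul_left_cancel₀ h4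
    rw [key, e1, e2, Finset.mul_sum, Finset.mul_sum]
    have split : ∑ p ∈ Finset.HasAntidiagonal.antidiagonal (n+1), (1 - q ^ (n+1)) *
          (qA q p.1 * (qPochC q q p.2)⁻¹ * (1 - z * q ^ p.1)⁻¹) =
        ∑ p ∈ Finset.HasAntidiagonal.antidiagonal (n+1),
          qA q p.1 * ((qPochC q q p.2)⁻¹ * (1 - q ^ p.2)) * (1 - z * q ^ p.1)⁻¹ +
        ∑ p ∈ Finset.HasAntidiagonal.antidiagonal (n+1),
          q ^ p.2 * (qA q p.1 * (1 - q ^ p.1)) * (qPochC q q p.2)⁻¹ * (1 - z * q ^ p.1)⁻¹ := by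
      rw [← Finset.sum_add_distrib]
      refine Finset.sum_congr rfl fun p hp => ?_
      rw [← Finset.HasAntidiagonal.mem_antidiagonal.mp hp, pow_add]
      ring
    rw [split, Finset.Nat.sum_antidiagonal_succ', Finset.Nat.sum_antidiagonal_succ]
    simp only [qB_succ q h, qA_succ q h, pow_zero, sub_self, mul_zero, zero_mul, zero_add]
    rw [sub_eq_add_neg, ← Finset.sum_neg_distrib]
    congr 1
    refine Finset.sum_congr rfl fun p hp => ?_
    rw [← Finset.HasAntidiagonal.mem_antidiagonal.mp hp, mul_assoc z q, ← pow_succ']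
    ring

lemma qlim (q : ℂ) (hq : ‖q‖ < 1) (z : ℂ) (hz : ∀ k : ℕ, 1 - z * q ^ k ≠ 0) :
    Filter.Tendsto (fun n => (qPochC z q n)⁻¹) Filter.atTop (nhds (qPochInfC z q)⁻¹) := by
  have hs : Summable (fun k : ℕ => ‖-(z * q ^ k)‖) := by
    simp only [norm_neg, norm_mul, norm_pow]
    exact (summable_geometric_of_lt_one (norm_nonneg _) hq).mul_left _
  have hne : qPochInfC z q ≠ 0 := by
    have := tprod_one_add_ne_zero_of_summable (f := fun k : ℕ => -(z * q ^ k))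
      (fun i => by simpa [sub_eq_add_neg] using hz i) hs
    simpa [qPochInfC, sub_eq_add_neg] using this
  refine Filter.Tendsto.inv₀ ?_ hne
  have hm := multipliable_one_add_of_summable hs
  simp only [← sub_eq_add_neg] at hm
  exact hm.hasProd.tendsto_prod_nat

/-- Karpelevich's partial fraction expansion of the q-exponential:
`e_q(z) = (1/(q;q)_∞) ∑_{k=0}^∞ (-1)^k q^{k(k+1)/2} / ((q;q)_k (1 - z q^k))`,
valid for any `z` avoiding the poles `q^{-k}`, with absolute convergence. -/
theorem stmt0 (q : ℝ) (hq0 : 0 < q) (hq1 : q < 1) (z : ℂ)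
    (hz : ∀ k : ℕ, z ≠ ((q : ℂ) ^ k)⁻¹) :
    Summable (fun k : ℕ => ‖(-1 : ℂ) ^ k * (q : ℂ) ^ (k * (k + 1) / 2) /
        (qPochC (q : ℂ) (q : ℂ) k * (1 - z * (q : ℂ) ^ k))‖) ∧
    qExpC (q : ℂ) z = (1 / qPochInfC (q : ℂ) (q : ℂ)) *
      ∑' k : ℕ, (-1 : ℂ) ^ k * (q : ℂ) ^ (k * (k + 1) / 2) /
        (qPochC (q : ℂ) (q : ℂ) k * (1 - z * (q : ℂ) ^ k)) := by
  have hqc : (q : ℂ) ≠ 0 := by exact_mod_cast hq0.ne'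
  have hnq : ‖(q : ℂ)‖ = q := by simp [abs_of_pos hq0]
  have hlt : ‖(q : ℂ)‖ < 1 := by rw [hnq]; exact hq1
  have h : ∀ k : ℕ, 1 - (q : ℂ) * (q : ℂ) ^ k ≠ 0 := fun k hk => by
    have h1 : (q : ℝ) ^ (k+1) < 1 := pow_lt_one₀ hq0.le hq1 (by simp)
    have h2 : ((q ^ (k+1) : ℝ) : ℂ) = 1 := by
      push_cast; rw [pow_succ']; exact (sub_eq_zero.mp hk).symm
    have h3 : q ^ (k+1) = 1 := by exact_mod_cast h2
    linarith
  have hz' : ∀ k : ℕ, 1 - z * (q : ℂ) ^ k ≠ 0 := fun k hk =>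
    hz k (eq_inv_of_mul_eq_one_left (sub_eq_zero.mp hk).symm)
  have hterm : ∀ k : ℕ, (-1 : ℂ) ^ k * (q : ℂ) ^ (k * (k + 1) / 2) /
        (qPochC (q : ℂ) (q : ℂ) k * (1 - z * (q : ℂ) ^ k)) =
        qA q k * (1 - z * (q : ℂ) ^ k)⁻¹ := fun k => by
    rw [qA, div_mul_eq_div_div, div_eq_mul_inv _ (1 - z * (q : ℂ) ^ k)]
  simp only [hterm]
  have lq := qlim q hlt q h
  have lz := qlim q hlt z hz'
  obtain ⟨C, hC⟩ := lq.norm.bddAbove_range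
  have hC : ∀ n, ‖(qPochC (q:ℂ) q n)⁻¹‖ ≤ C := fun n => hC ⟨n, rfl⟩
  have hC0 : 0 ≤ C := (norm_nonneg _).trans (hC 0)
  have lg : Filter.Tendsto (fun k : ℕ => (1 - z * (q : ℂ) ^ k)⁻¹) Filter.atTop (nhds 1) := by
    have := ((tendsto_pow_atTop_nhds_zero_of_norm_lt_one hlt).const_mul z).const_sub 1
    have := this.inv₀ (by simp)
    simpa using this
  obtain ⟨D, hD⟩ := lg.norm.bddAbove_range
  have hD : ∀ n : ℕ, ‖(1 - z * (q : ℂ) ^ n)⁻¹‖ ≤ D := fun n => hD ⟨n, rfl⟩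
  have hA : ∀ k, ‖qA q k‖ ≤ q ^ k * C := fun k => by
    rw [qA, div_eq_mul_inv, norm_mul, norm_mul, norm_pow, norm_pow, hnq]
    simp only [norm_neg, norm_one, one_pow, one_mul]
    refine mul_le_mul ?_ (hC k) (norm_nonneg _) (by positivity)
    refine pow_le_pow_of_le_one hq0.le hq1.le ?_
    rw [Nat.le_div_iff_mul_le (by norm_num)]
    rcases k with _ | k
    · simp
    · nlinarith
  have hsum : Summable (fun k : ℕ => ‖qA q k * (1 - z * (q : ℂ) ^ k)⁻¹‖) := by
    refine Summable.of_nonneg_of_le (fun _ => norm_nonneg _) (fun k => ?_)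
      (((summable_geometric_of_lt_one hq0.le hq1).mul_right C).mul_right D)
    rw [norm_mul]
    exact mul_le_mul (hA k) (hD k) (norm_nonneg _) (by positivity)
  refine ⟨hsum, ?_⟩
  have main := tendsto_tsum_of_dominated_convergence (𝓕 := Filter.atTop)
    (f := fun n k : ℕ => if k ≤ n then
      qA q k * (qPochC (q:ℂ) q (n-k))⁻¹ * (1 - z * (q : ℂ) ^ k)⁻¹ else 0)
    (g := fun k => (qPochInfC (q:ℂ) q)⁻¹ * (qA q k * (1 - z * (q : ℂ) ^ k)⁻¹))
    (hsum.mul_left C)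
    (fun k => by
      have l1 : Filter.Tendsto (fun n : ℕ => (qPochC (q:ℂ) q (n-k))⁻¹ *
          (qA q k * (1 - z * (q : ℂ) ^ k)⁻¹)) Filter.atTop (nhds ((qPochInfC (q:ℂ) q)⁻¹ *
          (qA q k * (1 - z * (q : ℂ) ^ k)⁻¹))) :=
        (lq.comp (Filter.tendsto_sub_atTop_nat k)).mul_const _
      refine l1.congr' ?_
      filter_upwards [Filter.eventually_ge_atTop k] with n hn
      rw [if_pos hn]; ring)
    (Filter.Eventually.of_forall fun n k => by
      split_ifs
      · rw [mul_right_comm, mul_comm, norm_mul]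
        exact mul_le_mul_of_nonneg_right (hC _) (norm_nonneg _)
      · rw [norm_zero]; positivity)
  rw [tsum_mul_left] at main
  have lz1 := lz.comp (Filter.tendsto_add_atTop_nat 1)
  rw [qExpC, one_div, one_div]
  refine tendsto_nhds_unique lz1 (main.congr fun n => ?_)
  rw [Function.comp_apply, qfinite q h n z hz',
    Finset.Nat.sum_antidiagonal_eq_sum_range_succ_mk, tsum_eq_sum (s := Finset.range (n+1))]
  · refine Finset.sum_congr rfl fun k hk => ?_
    rw [if_pos (by simpa [Nat.lt_succ_iff] using hk)]
  · intro k hk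
    rw [if_neg (by simpa [Nat.lt_succ_iff] using hk)]
end

section
/- Let 0 < q < 1 be real and let z be a real number that is not a nonpositive integer. Then the q²-Gamma function admits the representation Γ_{q²}(z) = (1−q²)^{1−z} · ∑_{k=0}^∞ (−1)^k q^{k(k+1)} / ((q²;q²)_k (1 − q^{2k+2z})), the series converging absolutely. -/
/-- The finite q-Pochhammer symbol `(a;q)_n = ∏_{j=0}^{n-1} (1 - a q^j)` (real version). -/
noncomputable def qPochR (a q : ℝ) (n : ℕ) : ℝ := ∏ j ∈ Finset.range n, (1 - a * q ^ j)

/-- The infinite q-Pochhammer symbol `(a;q)_∞ = ∏_{j=0}^{∞} (1 - a q^j)` (real version). -/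
noncomputable def qPochInfR (a q : ℝ) : ℝ := ∏' j : ℕ, (1 - a * q ^ j)

/-- The q²-Gamma function `Γ_{q²}(z) = ((q²;q²)_∞ / (q^{2z};q²)_∞) (1-q²)^{1-z}`,
with `q^{2z} = exp(2z ln q)`. -/
noncomputable def qGamma2 (q z : ℝ) : ℝ :=
  (qPochInfR (q ^ 2) (q ^ 2) / qPochInfR (Real.exp (2 * z * Real.log q)) (q ^ 2)) *
    (1 - q ^ 2) ^ (1 - z)

open Filter Topology

noncomputable def auxC (p : ℝ) (n k : ℕ) : ℝ := ∏ j ∈ Finset.range k, (1 - p ^ (n - j))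

noncomputable def auxA (q : ℝ) (k : ℕ) : ℝ :=
  (-1 : ℝ) ^ k * q ^ (k * (k + 1)) / qPochR (q ^ 2) (q ^ 2) k

lemma auxC_zero_of_lt (p : ℝ) (n k : ℕ) (h : n < k) : auxC p n k = 0 := by
  unfold auxC
  exact Finset.prod_eq_zero (Finset.mem_range.2 h) (by simp)

lemma auxC_succ (p : ℝ) (n k : ℕ) : auxC p n (k + 1) = auxC p n k * (1 - p ^ (n - k)) := by
  unfold auxC; rw [Finset.prod_range_succ]

lemma auxC_succ_succ (p : ℝ) (n k : ℕ) :
    auxC p (n + 1) (k + 1) = (1 - p ^ (n + 1)) * auxC p n k := by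
  unfold auxC
  rw [Finset.prod_range_succ', mul_comm]
  simp

lemma auxP_pos (q : ℝ) (hq0 : 0 < q) (hq1 : q < 1) (k : ℕ) : 0 < qPochR (q ^ 2) (q ^ 2) k := by
  unfold qPochR
  refine Finset.prod_pos fun j _ => ?_
  have : (q ^ 2) ^ (j + 1) < 1 := pow_lt_one₀ (by positivity) (by nlinarith) (by simp)
  rw [pow_succ'] at this
  linarith

lemma auxA_succ (q : ℝ) (hq0 : 0 < q) (hq1 : q < 1) (k : ℕ) :
    auxA q (k + 1) * (1 - (q ^ 2) ^ (k + 1)) = - auxA q k * (q ^ 2) ^ (k + 1) := by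
  have h1 := (auxP_pos q hq0 hq1 k).ne'
  have h2 := (auxP_pos q hq0 hq1 (k + 1)).ne'
  have e : qPochR (q ^ 2) (q ^ 2) (k + 1)
      = qPochR (q ^ 2) (q ^ 2) k * (1 - (q ^ 2) ^ (k + 1)) := by
    unfold qPochR; rw [Finset.prod_range_succ, pow_succ' (q ^ 2) k]
  have h3 : (1 - (q ^ 2) ^ (k + 1)) ≠ 0 := by
    intro h; rw [e, h] at h2; simp at h2
  have e2 : q ^ ((k + 1) * (k + 1 + 1)) = q ^ (k * (k + 1)) * (q ^ 2) ^ (k + 1) := by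
    rw [← pow_mul, ← pow_add]; congr 1; ring
  unfold auxA
  rw [e, e2, pow_succ (-1 : ℝ)]
  field_simp

lemma auxStep (q : ℝ) (hq0 : 0 < q) (hq1 : q < 1) (n k : ℕ) :
    auxA q (k + 1) * auxC (q ^ 2) (n + 1) (k + 1) =
      auxA q (k + 1) * auxC (q ^ 2) n (k + 1)
        - (q ^ 2) ^ (n + 1) * (auxA q k * auxC (q ^ 2) n k) := by
  rw [auxC_succ_succ, auxC_succ]
  rcases lt_or_ge n k with h | h
  · rw [auxC_zero_of_lt _ _ _ h]; simp
  · have e : (q ^ 2) ^ (n + 1) = (q ^ 2) ^ (n - k) * (q ^ 2) ^ (k + 1) := by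
      rw [← pow_add]; congr 1; omega
    rw [e]
    linear_combination (q ^ 2) ^ (n - k) * auxC (q ^ 2) n k * auxA_succ q hq0 hq1 k

lemma auxFinite (q : ℝ) (hq0 : 0 < q) (hq1 : q < 1) (n : ℕ) : ∀ x : ℝ,
    (∀ k : ℕ, 1 - (q ^ 2) ^ k * x ≠ 0) →
    ∑ k ∈ Finset.range (n + 1), auxA q k * auxC (q ^ 2) n k / (1 - (q ^ 2) ^ k * x)
      = qPochR (q ^ 2) (q ^ 2) n / qPochR x (q ^ 2) (n + 1) := by
  induction n with
  | zero => intro x hx; simp [auxA, auxC, qPochR]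
  | succ n ih =>
    intro x hx
    have hx' : ∀ k : ℕ, 1 - (q ^ 2) ^ k * (x * q ^ 2) ≠ 0 := by
      intro k
      have := hx (k + 1)
      rwa [pow_succ, mul_assoc, mul_comm (q ^ 2) x] at this
    have key : ∑ k ∈ Finset.range (n + 1 + 1),
        auxA q k * auxC (q ^ 2) (n + 1) k / (1 - (q ^ 2) ^ k * x)
        = ∑ k ∈ Finset.range (n + 1), auxA q k * auxC (q ^ 2) n k / (1 - (q ^ 2) ^ k * x)
        - (q ^ 2) ^ (n + 1) * ∑ k ∈ Finset.range (n + 1),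
          auxA q k * auxC (q ^ 2) n k / (1 - (q ^ 2) ^ k * (x * q ^ 2)) := by
      have e1 : ∑ k ∈ Finset.range (n + 1),
          auxA q k * auxC (q ^ 2) n k / (1 - (q ^ 2) ^ k * x)
          = ∑ k ∈ Finset.range (n + 1 + 1),
          auxA q k * auxC (q ^ 2) n k / (1 - (q ^ 2) ^ k * x) := by
        rw [Finset.sum_range_succ _ (n + 1), auxC_zero_of_lt _ n (n + 1) (by omega)]
        simp
      rw [e1, Finset.sum_range_succ', Finset.sum_range_succ' _ (n + 1), Finset.mul_sum,
        add_sub_right_comm, ← Finset.sum_sub_distrib]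
      congr 1
      refine Finset.sum_congr rfl fun k _ => ?_
      rw [auxStep q hq0 hq1, sub_div, mul_div_assoc ((q ^ 2) ^ (n + 1))]
      congr 4
      ring
    rw [key, ih x hx, ih _ hx']
    have ne : ∀ m, qPochR x (q ^ 2) m ≠ 0 := by
      intro m
      unfold qPochR
      refine Finset.prod_ne_zero_iff.2 fun j _ => ?_
      rw [mul_comm]; exact hx j
    have p1 : qPochR x (q ^ 2) (n + 1 + 1)
        = qPochR x (q ^ 2) (n + 1) * (1 - x * (q ^ 2) ^ (n + 1)) := by
      unfold qPochR; rw [Finset.prod_range_succ]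
    have p2 : qPochR x (q ^ 2) (n + 1 + 1) = qPochR (x * q ^ 2) (q ^ 2) (n + 1) * (1 - x) := by
      unfold qPochR; rw [Finset.prod_range_succ']
      simp only [pow_zero, mul_one]
      congr 1
      refine Finset.prod_congr rfl fun j _ => ?_
      ring
    have p3 : qPochR (q ^ 2) (q ^ 2) (n + 1)
        = qPochR (q ^ 2) (q ^ 2) n * (1 - (q ^ 2) ^ (n + 1)) := by
      unfold qPochR; rw [Finset.prod_range_succ, pow_succ' (q ^ 2) n]
    have n0 := ne (n + 1 + 1)
    have n1 := ne (n + 1)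
    have n2 : qPochR (x * q ^ 2) (q ^ 2) (n + 1) ≠ 0 := by
      intro h; rw [p2, h] at n0; simp at n0
    have d1 : qPochR (q ^ 2) (q ^ 2) n / qPochR x (q ^ 2) (n + 1)
        = qPochR (q ^ 2) (q ^ 2) n * (1 - x * (q ^ 2) ^ (n + 1)) / qPochR x (q ^ 2) (n + 1 + 1) := by
      rw [div_eq_div_iff n1 n0, p1]; ring
    have d2 : qPochR (q ^ 2) (q ^ 2) n / qPochR (x * q ^ 2) (q ^ 2) (n + 1)
        = qPochR (q ^ 2) (q ^ 2) n * (1 - x) / qPochR x (q ^ 2) (n + 1 + 1) := by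
      rw [div_eq_div_iff n2 n0, p2]; ring
    rw [d1, d2, p3]
    ring

lemma auxSummable (q : ℝ) (hq0 : 0 < q) (hq1 : q < 1) (x : ℝ)
    (hx : ∀ k : ℕ, 1 - (q ^ 2) ^ k * x ≠ 0) :
    Summable (fun k : ℕ => auxA q k / (1 - (q ^ 2) ^ k * x)) := by
  have hA : ∀ k, auxA q k ≠ 0 := by
    intro k
    have := auxP_pos q hq0 hq1 k
    unfold auxA
    exact div_ne_zero (mul_ne_zero (pow_ne_zero _ (by norm_num)) (by positivity)) this.ne'
  have hp : Tendsto (fun k : ℕ => (q ^ 2) ^ k) atTop (𝓝 0) :=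
    tendsto_pow_atTop_nhds_zero_of_lt_one (by positivity) (by nlinarith)
  have hp1 : Tendsto (fun k : ℕ => (q ^ 2) ^ (k + 1)) atTop (𝓝 0) :=
    hp.comp (tendsto_add_atTop_nat 1)
  refine summable_of_ratio_test_tendsto_lt_one (l := 0) (by norm_num)
    (Eventually.of_forall fun k => div_ne_zero (hA k) (hx k)) ?_
  have lim : Tendsto (fun k : ℕ => ‖-(q ^ 2) ^ (k + 1) / (1 - (q ^ 2) ^ (k + 1)) *
      ((1 - (q ^ 2) ^ k * x) / (1 - (q ^ 2) ^ (k + 1) * x))‖) atTop (𝓝 0) := by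
    have := ((hp1.neg.div (hp1.const_sub 1) (by norm_num)).mul
      (((hp.mul_const x).const_sub 1).div ((hp1.mul_const x).const_sub 1) (by norm_num))).norm
    simpa using this
  refine lim.congr fun k => ?_
  rw [← norm_div]
  congr 1
  have h3 : (1 - (q ^ 2) ^ (k + 1)) ≠ 0 := by
    have : (q ^ 2) ^ (k + 1) < 1 := pow_lt_one₀ (by positivity) (by nlinarith) (by simp)
    linarith
  have e : auxA q (k + 1) = - auxA q k * (q ^ 2) ^ (k + 1) / (1 - (q ^ 2) ^ (k + 1)) := by
    rw [eq_div_iff h3]; exact auxA_succ q hq0 hq1 k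
  have := hx k
  have := hx (k + 1)
  have := hA k
  rw [e, div_div_div_eq, div_mul_div_comm, div_mul_eq_mul_div, div_div]
  rw [div_eq_div_iff (by positivity) (by positivity)]
  ring

lemma auxTendsto (q : ℝ) (hq0 : 0 < q) (hq1 : q < 1) (x : ℝ) :
    Summable (fun j : ℕ => ‖-(x * (q ^ 2) ^ j)‖) ∧
    Tendsto (fun n => qPochR x (q ^ 2) n) atTop (𝓝 (qPochInfR x (q ^ 2))) := by
  have hs : Summable (fun j : ℕ => ‖-(x * (q ^ 2) ^ j)‖) :=
    (((summable_geometric_of_lt_one (by positivity) (by nlinarith)).mul_left x).neg).norm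
  refine ⟨hs, ?_⟩
  have := (multipliable_one_add_of_summable hs).hasProd.tendsto_prod_nat
  simpa only [qPochR, qPochInfR, sub_eq_add_neg] using this

lemma auxMain (q : ℝ) (hq0 : 0 < q) (hq1 : q < 1) (x : ℝ)
    (hx : ∀ k : ℕ, 1 - (q ^ 2) ^ k * x ≠ 0) :
    qPochInfR (q ^ 2) (q ^ 2) / qPochInfR x (q ^ 2)
      = ∑' k : ℕ, auxA q k / (1 - (q ^ 2) ^ k * x) := by
  have hp : Tendsto (fun k : ℕ => (q ^ 2) ^ k) atTop (𝓝 0) :=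
    tendsto_pow_atTop_nhds_zero_of_lt_one (by positivity) (by nlinarith)
  have hne : qPochInfR x (q ^ 2) ≠ 0 := by
    have := tprod_one_add_ne_zero_of_summable (f := fun j : ℕ => -(x * (q ^ 2) ^ j))
      (fun i => by have := hx i; rwa [mul_comm, sub_eq_add_neg] at this)
      (auxTendsto q hq0 hq1 x).1
    simpa only [qPochInfR, sub_eq_add_neg] using this
  have l1 : Tendsto (fun n => qPochR (q ^ 2) (q ^ 2) n / qPochR x (q ^ 2) (n + 1)) atTop
      (𝓝 (qPochInfR (q ^ 2) (q ^ 2) / qPochInfR x (q ^ 2))) :=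
    (auxTendsto q hq0 hq1 (q ^ 2)).2.div
      ((auxTendsto q hq0 hq1 x).2.comp (tendsto_add_atTop_nat 1)) hne
  have l2 : Tendsto (fun n => ∑' k : ℕ, auxA q k * auxC (q ^ 2) n k / (1 - (q ^ 2) ^ k * x)) atTop
      (𝓝 (∑' k : ℕ, auxA q k / (1 - (q ^ 2) ^ k * x))) := by
    refine tendsto_tsum_of_dominated_convergence (auxSummable q hq0 hq1 x hx).norm ?_ ?_
    · intro k
      have hc : Tendsto (fun n => auxC (q ^ 2) n k) atTop (𝓝 1) := by
        unfold auxC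
        have := tendsto_finsetProd (Finset.range k) (f := fun j n => 1 - (q ^ 2) ^ (n - j))
          (a := fun _ => (1 : ℝ)) (x := atTop) (fun j _ => by
            have := (hp.comp (tendsto_sub_atTop_nat j)).const_sub 1
            simpa using this)
        simpa using this
      simpa using (hc.const_mul (auxA q k)).div_const (1 - (q ^ 2) ^ k * x)
    · refine Eventually.of_forall fun n k => ?_
      rw [mul_div_right_comm, norm_mul]
      refine mul_le_of_le_one_right (norm_nonneg _) ?_
      unfold auxC
      rw [norm_prod]
      refine Finset.prod_le_one (fun _ _ => norm_nonneg _) fun j _ => ?_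
      have h1 : (q ^ 2) ^ (n - j) ≤ 1 := pow_le_one₀ (by positivity) (by nlinarith)
      have h2 : 0 ≤ (q ^ 2) ^ (n - j) := by positivity
      rw [Real.norm_eq_abs, abs_le]
      constructor <;> linarith
  refine tendsto_nhds_unique l1 (l2.congr fun n => ?_)
  rw [← auxFinite q hq0 hq1 n x hx]
  refine tsum_eq_sum fun k hk => ?_
  rw [auxC_zero_of_lt _ _ _ (by simpa using hk)]
  simp

/-- Partial fraction representation of the q²-Gamma function:
`Γ_{q²}(z) = (1-q²)^{1-z} ∑_{k=0}^∞ (-1)^k q^{k(k+1)} / ((q²;q²)_k (1 - q^{2k+2z}))`,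
the series converging absolutely. -/
theorem stmt2 (q : ℝ) (hq0 : 0 < q) (hq1 : q < 1) (z : ℝ)
    (hz : ∀ m : ℕ, z ≠ -(m : ℝ)) :
    Summable (fun k : ℕ => |(-1 : ℝ) ^ k * q ^ (k * (k + 1)) /
        (qPochR (q ^ 2) (q ^ 2) k * (1 - q ^ (2 * k) * Real.exp (2 * z * Real.log q)))|) ∧
    qGamma2 q z = (1 - q ^ 2) ^ (1 - z) *
      ∑' k : ℕ, (-1 : ℝ) ^ k * q ^ (k * (k + 1)) /
        (qPochR (q ^ 2) (q ^ 2) k * (1 - q ^ (2 * k) * Real.exp (2 * z * Real.log q))) := by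
  have hx : ∀ k : ℕ, 1 - (q ^ 2) ^ k * Real.exp (2 * z * Real.log q) ≠ 0 := by
    intro k h
    have hl : Real.log q < 0 := Real.log_neg hq0 hq1
    have e : (q ^ 2) ^ k = Real.exp (2 * k * Real.log q) := by
      rw [← pow_mul, ← Real.rpow_natCast, Real.rpow_def_of_pos hq0]
      push_cast
      congr 1; ring
    rw [e, ← Real.exp_add, sub_eq_zero, eq_comm, Real.exp_eq_one_iff] at h
    have h2 : (z + k) * Real.log q = 0 := by linarith
    rcases mul_eq_zero.1 h2 with h3 | h3
    · exact hz k (by linarith)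
    · exact hl.ne h3
  have e : (fun k : ℕ => (-1 : ℝ) ^ k * q ^ (k * (k + 1)) /
        (qPochR (q ^ 2) (q ^ 2) k * (1 - q ^ (2 * k) * Real.exp (2 * z * Real.log q))))
      = fun k : ℕ => auxA q k / (1 - (q ^ 2) ^ k * Real.exp (2 * z * Real.log q)) := by
    funext k
    rw [auxA, div_div, pow_mul q 2 k]
  refine ⟨?_, ?_⟩
  · have := auxSummable q hq0 hq1 _ hx
    rw [← e] at this
    exact this.abs
  · rw [e, ← auxMain q hq0 hq1 _ hx, qGamma2, mul_comm]
end

section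
/- Let 0 < q < 1 be real and let n ≥ 0 be an integer. Then, as real z → −n through values that are not nonpositive integers, the quotient ψ_{q²}(z)/Γ_{q²}(z) tends to the limit (−1)^n q^{−n(n+1)} (q²;q²)_n ln(q²) / (1−q²)^{n+1}. -/
/-- The q²-psi function: the logarithmic derivative of the q²-Gamma function. -/
noncomputable def qPsi2 (q z : ℝ) : ℝ := deriv (qGamma2 q) z / qGamma2 q z

lemma aux_mult (p a : ℝ) (hp0 : 0 < p) (hp1 : p < 1) :
    Multipliable (fun j : ℕ => 1 - a * p ^ j) := by
  have := multipliable_one_add_of_summable (f := fun j : ℕ => -(a * p ^ j)) (by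
    simp only [norm_neg, norm_mul, norm_pow, Real.norm_eq_abs, abs_of_pos hp0]
    exact (summable_geometric_of_lt_one hp0.le hp1).mul_left _)
  simpa [sub_eq_add_neg] using this

lemma aux_ne (p a : ℝ) (hp0 : 0 < p) (hp1 : p < 1) (h : ∀ j : ℕ, 1 - a * p ^ j ≠ 0) :
    qPochInfR a p ≠ 0 := by
  have := tprod_one_add_ne_zero_of_summable (f := fun j : ℕ => -(a * p ^ j))
    (fun i => by simpa [sub_eq_add_neg] using h i) (by
    simp only [norm_neg, norm_mul, norm_pow, Real.norm_eq_abs, abs_of_pos hp0]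
    exact (summable_geometric_of_lt_one hp0.le hp1).mul_left _)
  simpa [qPochInfR, sub_eq_add_neg] using this

lemma aux_contDiff (p : ℝ) (hp0 : 0 < p) (hp1 : p < 1) :
    ContDiff ℝ 1 (fun a : ℝ => qPochInfR a p) := by
  have hd : Differentiable ℂ (fun a : ℂ => ∏' j : ℕ, (1 + -(a * (p : ℂ) ^ j))) := by
    intro a
    have hP := Summable.hasProdLocallyUniformlyOn_nat_one_add (R := ℂ)
      (f := fun (j : ℕ) (a : ℂ) => -(a * (p : ℂ) ^ j))
      (K := Metric.ball (0 : ℂ) (‖a‖ + 1)) Metric.isOpen_ball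
      (u := fun j : ℕ => (‖a‖ + 1) * p ^ j)
      ((summable_geometric_of_lt_one hp0.le hp1).mul_left _)
      (Filter.Eventually.of_forall fun j x hx => by
        simp only [norm_neg, norm_mul, norm_pow, Complex.norm_real, Real.norm_eq_abs,
          abs_of_pos hp0]
        have : ‖x‖ < ‖a‖ + 1 := by simpa using hx
        gcongr) (fun _ => by fun_prop)
    have := hP.differentiableOn
      (.of_forall fun _ ↦ by simpa [Finset.prod_fn] using
        DifferentiableOn.finsetProd (fun _ _ ↦ by fun_prop)) Metric.isOpen_ball
    exact this.differentiableAt (Metric.isOpen_ball.mem_nhds (by simp))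
  have h1 : ContDiff ℝ 1 (fun a : ℝ => (∏' j : ℕ, (1 + -((a : ℂ) * (p : ℂ) ^ j))).re) :=
    (hd.contDiff (n := 1)).real_of_complex
  convert h1 using 2 with a
  have := (aux_mult p a hp0 hp1).map_tprod Complex.ofRealHom Complex.continuous_ofReal
  have h2 : ((qPochInfR a p : ℝ) : ℂ) = ∏' j : ℕ, (1 + -((a : ℂ) * (p : ℂ) ^ j)) := by
    rw [qPochInfR]
    refine this.trans ?_
    congr 1
    ext j
    simp [sub_eq_add_neg]
  rw [← h2, Complex.ofReal_re]

lemma aux_split (p a : ℝ) (hp0 : 0 < p) (hp1 : p < 1) (n : ℕ) :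
    qPochInfR a p = (1 - a * p ^ n) * (qPochR a p n * qPochInfR (a * p ^ (n + 1)) p) := by
  have hm : Multipliable (fun j : ℕ => 1 - a * p ^ (j + (n + 1))) := by
    have := aux_mult p (a * p ^ (n + 1)) hp0 hp1
    refine this.congr fun j => ?_
    ring
  have := hm.prod_mul_tprod_nat_mul' (f := fun j : ℕ => 1 - a * p ^ j) (k := n + 1)
  rw [qPochInfR, ← this, Finset.prod_range_succ, qPochR, qPochInfR]
  have h3 : (∏' j : ℕ, (1 - a * p ^ (j + (n + 1)))) = ∏' j : ℕ, (1 - a * p ^ (n + 1) * p ^ j) := by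
    congr 1
    ext j
    ring
  rw [h3]
  ring

lemma aux_fin (q : ℝ) (hq : q ≠ 0) (n : ℕ) :
    qPochR (((q ^ 2) ^ n)⁻¹) (q ^ 2) n * q ^ (n * (n + 1)) =
      (-1) ^ n * qPochR (q ^ 2) (q ^ 2) n := by
  induction n with
  | zero => simp [qPochR]
  | succ n ih =>
    have h1 : qPochR (((q ^ 2) ^ (n + 1))⁻¹) (q ^ 2) (n + 1) =
        qPochR (((q ^ 2) ^ n)⁻¹) (q ^ 2) n * (1 - ((q ^ 2) ^ (n + 1))⁻¹) := by
      rw [qPochR, Finset.prod_range_succ', qPochR]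
      congr 1
      · refine Finset.prod_congr rfl fun j _ => ?_
        field_simp
        ring
      · simp
    have h2 : qPochR (q ^ 2) (q ^ 2) (n + 1) =
        qPochR (q ^ 2) (q ^ 2) n * (1 - (q ^ 2) ^ (n + 1)) := by
      rw [qPochR, Finset.prod_range_succ, qPochR]
      ring
    have h3 : q ^ ((n + 1) * (n + 1 + 1)) = q ^ (n * (n + 1)) * (q ^ 2) ^ (n + 1) := by
      rw [← pow_mul, ← pow_add]; congr 1; ring
    have h4 : (1 - ((q ^ 2) ^ (n + 1))⁻¹) * (q ^ 2) ^ (n + 1) = -(1 - (q ^ 2) ^ (n + 1)) := by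
      have : (q ^ 2) ^ (n + 1) ≠ 0 := by positivity
      field_simp
      ring
    rw [h1, h2, h3]
    calc _ = (qPochR (((q ^ 2) ^ n)⁻¹) (q ^ 2) n * q ^ (n * (n + 1))) *
          ((1 - ((q ^ 2) ^ (n + 1))⁻¹) * (q ^ 2) ^ (n + 1)) := by ring
      _ = _ := by rw [ih, h4]; ring

theorem stmt4 (q : ℝ) (hq0 : 0 < q) (hq1 : q < 1) (n : ℕ) :
    Filter.Tendsto (fun z : ℝ => qPsi2 q z / qGamma2 q z)
      (nhdsWithin (-(n : ℝ)) {z : ℝ | ∀ m : ℕ, z ≠ -(m : ℝ)})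
      (nhds ((-1 : ℝ) ^ n * (q ^ (-((n : ℝ) * ((n : ℝ) + 1))) * qPochR (q ^ 2) (q ^ 2) n *
        Real.log (q ^ 2) / (1 - q ^ 2) ^ (n + 1)))) := by
  have hp0 : 0 < q ^ 2 := by positivity
  have hp1 : q ^ 2 < 1 := by nlinarith
  have h1p : 0 < 1 - q ^ 2 := by linarith
  have hlog : Real.log q < 0 := Real.log_neg hq0 hq1
  have hexp : ∀ (z : ℝ) (j : ℕ), Real.exp (2 * z * Real.log q) * (q ^ 2) ^ j =
      Real.exp (2 * (z + j) * Real.log q) := by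
    intro z j
    have : (q ^ 2) ^ j = Real.exp (2 * j * Real.log q) := by
      rw [← pow_mul, ← Real.rpow_natCast, Real.rpow_def_of_pos hq0]
      congr 1; push_cast; ring
    rw [this, ← Real.exp_add]; congr 1; ring
  set P := qPochInfR (q ^ 2) (q ^ 2) with hP
  have hPne : P ≠ 0 := by
    refine aux_ne _ _ hp0 hp1 fun j => ?_
    rw [← pow_succ']
    have : (q ^ 2) ^ (j + 1) < 1 := pow_lt_one₀ hp0.le hp1 (by simp)
    linarith
  have hG := aux_contDiff _ hp0 hp1
  have hE : ContDiff ℝ 1 (fun z : ℝ => Real.exp (2 * z * Real.log q)) := by fun_prop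
  have hR : ContDiff ℝ 1 (fun z : ℝ => (1 - q ^ 2) ^ (z - 1)) := by
    have : (fun z : ℝ => (1 - q ^ 2) ^ (z - 1)) =
        fun z : ℝ => Real.exp (Real.log (1 - q ^ 2) * (z - 1)) := by
      ext z; rw [Real.rpow_def_of_pos h1p]
    rw [this]; fun_prop
  set H : ℝ → ℝ := fun z => qPochInfR (Real.exp (2 * z * Real.log q)) (q ^ 2) / P *
    (1 - q ^ 2) ^ (z - 1) with hH
  have hHc : ContDiff ℝ 1 H := ((hG.comp hE).div_const P).mul hR
  have hΓ : qGamma2 q = fun z => (H z)⁻¹ := by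
    ext z
    simp only [qGamma2, hH]
    rw [mul_inv, inv_div, ← Real.rpow_neg h1p.le]
    congr 2; ring
  have hHne : ∀ z : ℝ, (∀ m : ℕ, z ≠ -(m : ℝ)) → H z ≠ 0 := by
    intro z hz
    refine mul_ne_zero (div_ne_zero ?_ hPne) (Real.rpow_pos_of_pos h1p _).ne'
    refine aux_ne _ _ hp0 hp1 fun j => ?_
    rw [hexp, sub_ne_zero]
    intro h
    have h5 := (Real.exp_eq_one_iff _).1 h.symm
    have : z + j = 0 := by
      rcases mul_eq_zero.1 h5 with h | h
      · linarith
      · exact absurd h hlog.ne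
    exact hz j (by linarith)
  have hHd : ∀ z, HasDerivAt H (deriv H z) z := fun z =>
    (hHc.differentiable (by norm_num) z).hasDerivAt
  have key : ∀ z : ℝ, (∀ m : ℕ, z ≠ -(m : ℝ)) → -deriv H z = qPsi2 q z / qGamma2 q z := by
    intro z hz
    have hne := hHne z hz
    rw [qPsi2, hΓ, ((hHd z).fun_inv hne).deriv]
    field_simp
  have hcont : Continuous (deriv H) := hHc.continuous_deriv (by norm_num)
  -- derivative at -n
  set K : ℝ → ℝ := fun z => qPochR (Real.exp (2 * z * Real.log q)) (q ^ 2) n *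
    qPochInfR (Real.exp (2 * z * Real.log q) * (q ^ 2) ^ (n + 1)) (q ^ 2) / P *
    (1 - q ^ 2) ^ (z - 1) with hK
  have hKd : ContDiff ℝ 1 K := by
    refine ContDiff.mul (ContDiff.div_const (ContDiff.mul ?_ ?_) P) hR
    · unfold qPochR
      exact contDiff_prod fun j _ => by fun_prop
    · exact hG.comp (hE.mul contDiff_const)
  have hHK : H = fun z => (1 - Real.exp (2 * (z + n) * Real.log q)) * K z := by
    ext z
    simp only [hH, hK]
    rw [aux_split _ _ hp0 hp1 n, hexp]
    ring
  have hder : deriv H (-(n : ℝ)) = -(2 * Real.log q) * K (-(n : ℝ)) := by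
    have h6 : HasDerivAt (fun z : ℝ => 1 - Real.exp (2 * (z + n) * Real.log q))
        (-(Real.exp (2 * (-(n : ℝ) + n) * Real.log q) * (2 * 1 * Real.log q))) (-(n : ℝ)) :=
      (((((hasDerivAt_id _).add_const _).const_mul 2).mul_const _).exp).const_sub 1
    have h7 := (hKd.differentiable (by norm_num) (-(n : ℝ))).hasDerivAt
    rw [hHK, (h6.fun_mul h7).deriv]
    simp
  have hEn : Real.exp (2 * (-(n : ℝ)) * Real.log q) = ((q ^ 2) ^ n)⁻¹ := by
    have := hexp (-(n : ℝ)) n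
    simp only [neg_add_cancel, mul_zero, zero_mul, Real.exp_zero] at this
    exact eq_inv_of_mul_eq_one_left this
  have hval : -deriv H (-(n : ℝ)) = (-1 : ℝ) ^ n * (q ^ (-((n : ℝ) * ((n : ℝ) + 1))) *
      qPochR (q ^ 2) (q ^ 2) n * Real.log (q ^ 2) / (1 - q ^ 2) ^ (n + 1)) := by
    have e1 : ((q ^ 2) ^ n)⁻¹ * (q ^ 2) ^ (n + 1) = q ^ 2 := by
      field_simp
      ring
    have e2 : q ^ (-((n : ℝ) * ((n : ℝ) + 1))) = (q ^ (n * (n + 1)))⁻¹ := by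
      rw [Real.rpow_neg hq0.le, ← Real.rpow_natCast]
      push_cast; rfl
    have e3 : (1 - q ^ 2) ^ (-(n : ℝ) - 1) = ((1 - q ^ 2) ^ (n + 1))⁻¹ := by
      rw [← Real.rpow_natCast (1 - q ^ 2) (n + 1), ← Real.rpow_neg h1p.le]
      congr 1; push_cast; ring
    have e4 : qPochR (((q ^ 2) ^ n)⁻¹) (q ^ 2) n =
        (-1) ^ n * qPochR (q ^ 2) (q ^ 2) n * (q ^ (n * (n + 1)))⁻¹ := by
      rw [← aux_fin q hq0.ne' n, mul_assoc, mul_inv_cancel₀ (by positivity), mul_one]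
    rw [hder]
    simp only [hK]
    rw [hEn, e1, e2, e3, e4, ← hP, mul_div_assoc, div_self hPne, Real.log_pow]
    push_cast
    ring
  rw [← hval]
  refine Filter.Tendsto.congr' ?_ ((hcont.neg.tendsto _).mono_left nhdsWithin_le_nhds)
  filter_upwards [self_mem_nhdsWithin] with z hz using key z hz
end

section
/- Let 0 < q < 1 be real and let ν be real. Define, for complex z with |z| > 2q/(1−q²), φ_ν(z) = ∑_{k=0}^∞ [2^k q^k (q^{ν+1/2};q)_k (q^{−ν+1/2};q)_k / ((1−q²)^k (q²;q²)_k)] z^{−k}. Then: (i) this series converges absolutely for |z| > 2q/(1−q²) and equals the basic hypergeometric value ₂Φ₁(q^{ν+1/2}, q^{−ν+1/2}; −q; q, 2q/((1−q²)z)); (ii) for every complex z with |z| > 2/(1−q²), φ_ν satisfies the q-difference equation [1 + q^{−1}(1−q²)z/2]·q·φ_ν(q^{−1}z) − q^{1/2}(q^{−ν} + q^{ν})·φ_ν(z) + [1 − (1−q²)z/2]·φ_ν(qz) = 0. -/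
/-- The basic hypergeometric series `₂Φ₁(a,b;c;q,x)`. -/
noncomputable def basicHyp21 (a b c q x : ℂ) : ℂ :=
  ∑' n : ℕ, qPochC a q n * qPochC b q n / (qPochC q q n * qPochC c q n) * x ^ n

/-- The coefficient `2^k q^k (q^{ν+1/2};q)_k (q^{-ν+1/2};q)_k / ((1-q²)^k (q²;q²)_k)`. -/
noncomputable def phiCoef (q ν : ℝ) (k : ℕ) : ℝ :=
  2 ^ k * q ^ k * qPochR (q ^ (ν + 1 / 2)) q k * qPochR (q ^ (-ν + 1 / 2)) q k /
    ((1 - q ^ 2) ^ k * qPochR (q ^ 2) (q ^ 2) k)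

/-- The Laurent-type series `φ_ν(z) = ∑_{k=0}^∞ phiCoef k · z^{-k}`. -/
noncomputable def Phi (q ν : ℝ) (z : ℂ) : ℂ := ∑' k : ℕ, (phiCoef q ν k : ℂ) * z⁻¹ ^ k

theorem aux_sq_lt {q : ℝ} (hq0 : 0 < q) (hq1 : q < 1) (k : ℕ) : 0 < 1 - q ^ (2 * k + 2) := by
  have := pow_lt_one₀ hq0.le hq1 (n := 2 * k + 2) (by omega)
  linarith

theorem aux_den_ne {q : ℝ} (hq0 : 0 < q) (hq1 : q < 1) (k : ℕ) : qPochR (q ^ 2) (q ^ 2) k ≠ 0 := by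
  unfold qPochR
  rw [Finset.prod_ne_zero_iff]
  intro j _
  have := aux_sq_lt hq0 hq1 j
  have h2 : q ^ 2 * (q ^ 2) ^ j = q ^ (2 * j + 2) := by ring
  rw [h2]; exact this.ne'

theorem aux_rec {q : ℝ} (hq0 : 0 < q) (hq1 : q < 1) (ν : ℝ) (k : ℕ) :
    phiCoef q ν (k + 1) = phiCoef q ν k * (2 * q / (1 - q ^ 2) *
      ((1 - q ^ (ν + 1 / 2) * q ^ k) * (1 - q ^ (-ν + 1 / 2) * q ^ k) / (1 - q ^ (2 * k + 2)))) := by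
  have h1 := aux_den_ne hq0 hq1 k
  have h2 := (aux_sq_lt hq0 hq1 k).ne'
  have h3 : 1 - q ^ 2 ≠ 0 := by simpa using (aux_sq_lt hq0 hq1 0).ne'
  have e : ∀ a p : ℝ, qPochR a p (k + 1) = qPochR a p k * (1 - a * p ^ k) := fun a p => by
    simp [qPochR, Finset.prod_range_succ]
  unfold phiCoef
  rw [e, e, e]
  have h4 : q ^ 2 * (q ^ 2) ^ k = q ^ (2 * k + 2) := by ring
  rw [h4]
  generalize q ^ (ν + 1 / 2) = a
  generalize q ^ (-ν + 1 / 2) = b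
  generalize qPochR a q k = A
  generalize qPochR b q k = B
  generalize qPochR (q ^ 2) (q ^ 2) k = C at *
  rw [pow_succ, pow_succ, pow_succ (1 - q ^ 2)]
  generalize 1 - q ^ (2 * k + 2) = D at *
  generalize 1 - q ^ 2 = E at *
  field_simp

open Filter Topology in
theorem aux_summable {q : ℝ} (hq0 : 0 < q) (hq1 : q < 1) (ν : ℝ) (z : ℂ)
    (hz : 2 * q / (1 - q ^ 2) < ‖z‖) :
    Summable (fun k : ℕ => ‖(phiCoef q ν k : ℂ) * z⁻¹ ^ k‖) := by
  have h3 : 0 < 1 - q ^ 2 := by simpa using aux_sq_lt hq0 hq1 0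
  have hz0 : 0 < ‖z‖ := lt_trans (by positivity) hz
  set R : ℕ → ℝ := fun k => 2 * q / (1 - q ^ 2) *
      ((1 - q ^ (ν + 1 / 2) * q ^ k) * (1 - q ^ (-ν + 1 / 2) * q ^ k) / (1 - q ^ (2 * k + 2))) with hR
  have hp : Tendsto (fun k : ℕ => q ^ k) atTop (𝓝 0) :=
    tendsto_pow_atTop_nhds_zero_of_lt_one hq0.le hq1
  have hp2 : Tendsto (fun k : ℕ => q ^ (2 * k + 2)) atTop (𝓝 0) :=
    hp.comp (tendsto_atTop_mono (fun k => by omega : ∀ k : ℕ, k ≤ 2 * k + 2) tendsto_id)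
  have hlim : Tendsto (fun k => |R k| * ‖z‖⁻¹) atTop
      (𝓝 (|2 * q / (1 - q ^ 2) * ((1 - q ^ (ν + 1 / 2) * 0) * (1 - q ^ (-ν + 1 / 2) * 0) / (1 - 0))|
        * ‖z‖⁻¹)) := by
    refine Tendsto.mul_const _ (Tendsto.abs (Tendsto.const_mul _ (Tendsto.div ?_ ?_ (by norm_num))))
    · exact ((hp.const_mul _).const_sub _).mul ((hp.const_mul _).const_sub _)
    · exact hp2.const_sub _
  have hlt : |2 * q / (1 - q ^ 2) * ((1 - q ^ (ν + 1 / 2) * 0) * (1 - q ^ (-ν + 1 / 2) * 0) / (1 - 0))|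
        * ‖z‖⁻¹ < 1 := by
    have : 0 < 2 * q / (1 - q ^ 2) := by positivity
    simp only [mul_zero, sub_zero, mul_one, div_one]
    rw [abs_of_pos this, ← div_eq_mul_inv, div_lt_one hz0]
    exact hz
  obtain ⟨r, hr1, hr2⟩ := exists_between hlt
  refine summable_of_ratio_norm_eventually_le hr2 ?_
  filter_upwards [hlim.eventually (eventually_le_nhds hr1)] with k hk
  rw [norm_norm, norm_norm, aux_rec hq0 hq1]
  have : ‖((phiCoef q ν k * R k : ℝ) : ℂ) * z⁻¹ ^ (k + 1)‖
      = (|R k| * ‖z‖⁻¹) * ‖(phiCoef q ν k : ℂ) * z⁻¹ ^ k‖ := by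
    rw [pow_succ]
    simp only [norm_mul, Complex.norm_real, Real.norm_eq_abs, norm_inv, norm_pow]
    ring
  rw [this]
  gcongr

theorem aux_term {q : ℝ} (ν : ℝ) (z : ℂ) (k : ℕ) :
    (phiCoef q ν k : ℂ) * z⁻¹ ^ k =
    qPochC ((q ^ (ν + 1 / 2) : ℝ) : ℂ) q k * qPochC ((q ^ (-ν + 1 / 2) : ℝ) : ℂ) q k /
      (qPochC q q k * qPochC (-(q : ℂ)) q k) * (2 * (q : ℂ) / ((1 - (q : ℂ) ^ 2) * z)) ^ k := by
  have e : ∀ a p : ℝ, ((qPochR a p k : ℝ) : ℂ) = qPochC a p k := fun a p => by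
    simp [qPochR, qPochC]
  have hd : qPochC q q k * qPochC (-(q : ℂ)) q k = qPochC ((q ^ 2 : ℝ) : ℂ) ((q ^ 2 : ℝ) : ℂ) k := by
    unfold qPochC
    rw [← Finset.prod_mul_distrib]
    refine Finset.prod_congr rfl fun j _ => ?_
    push_cast
    ring
  rw [hd]
  unfold phiCoef
  push_cast [e]
  rw [div_pow, mul_pow, mul_pow, inv_pow]
  simp only [div_eq_mul_inv, mul_inv]
  ring

theorem stmt14 (q : ℝ) (hq0 : 0 < q) (hq1 : q < 1) (ν : ℝ) :
    (∀ z : ℂ, 2 * q / (1 - q ^ 2) < ‖z‖ →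
      Summable (fun k : ℕ => ‖(phiCoef q ν k : ℂ) * z⁻¹ ^ k‖) ∧
      Phi q ν z = basicHyp21 ((q ^ (ν + 1 / 2) : ℝ) : ℂ) ((q ^ (-ν + 1 / 2) : ℝ) : ℂ)
        (-(q : ℂ)) (q : ℂ) (2 * (q : ℂ) / ((1 - (q : ℂ) ^ 2) * z))) ∧
    (∀ z : ℂ, 2 / (1 - q ^ 2) < ‖z‖ →
      (1 + (q : ℂ)⁻¹ * (1 - (q : ℂ) ^ 2) * z / 2) * (q : ℂ) * Phi q ν ((q : ℂ)⁻¹ * z)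
        - ((q ^ ((1 : ℝ) / 2) : ℝ) : ℂ) * (((q ^ (-ν) : ℝ) : ℂ) + ((q ^ ν : ℝ) : ℂ)) * Phi q ν z
        + (1 - (1 - (q : ℂ) ^ 2) * z / 2) * Phi q ν ((q : ℂ) * z) = 0) := by
  refine ⟨fun z hz => ⟨aux_summable hq0 hq1 ν z hz, ?_⟩, fun z hz => ?_⟩
  · unfold Phi basicHyp21
    exact tsum_congr fun k => aux_term ν z k
  have h3 : 0 < 1 - q ^ 2 := by simpa using aux_sq_lt hq0 hq1 0
  have hz0 : 0 < ‖z‖ := lt_trans (by positivity) hz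
  have hzne : z ≠ 0 := norm_pos_iff.1 hz0
  have hqC : (q : ℂ) ≠ 0 := by exact_mod_cast hq0.ne'
  have hz2 : 2 * q / (1 - q ^ 2) < q * ‖z‖ := by
    have := mul_lt_mul_of_pos_left hz hq0
    calc 2 * q / (1 - q ^ 2) = q * (2 / (1 - q ^ 2)) := by ring
      _ < _ := this
  have hz1 : 2 * q / (1 - q ^ 2) < ‖z‖ := by nlinarith
  have hzi : 2 * q / (1 - q ^ 2) < q⁻¹ * ‖z‖ := by
    have : 1 < q⁻¹ := (one_lt_inv₀ hq0).2 hq1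
    nlinarith
  have H : ∀ w : ℂ, 2 * q / (1 - q ^ 2) < ‖w‖ →
      HasSum (fun k : ℕ => (phiCoef q ν k : ℂ) * w⁻¹ ^ k) (Phi q ν w) := fun w hw =>
    (aux_summable hq0 hq1 ν w hw).of_norm.hasSum
  have H0 := H ((q : ℂ)⁻¹ * z) (by simpa [abs_of_pos hq0] using hzi)
  have H1 := H z hz1
  have H2 := H ((q : ℂ) * z) (by simpa [abs_of_pos hq0] using hz2)
  have Hu := H0.sub H2
  rw [← hasSum_nat_add_iff' 1] at Hu
  simp only [Finset.range_one, Finset.sum_singleton, pow_zero, sub_self, sub_zero] at Hu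
  have hab : q ^ (ν + 1 / 2) * q ^ (-ν + 1 / 2) = q := by
    rw [← Real.rpow_add hq0]
    ring_nf
    exact Real.rpow_one q
  have hs : q ^ ((1 : ℝ) / 2) * (q ^ (-ν) + q ^ ν) = q ^ (ν + 1 / 2) + q ^ (-ν + 1 / 2) := by
    rw [Real.rpow_add hq0, Real.rpow_add hq0]; ring
  have hsC : ((q ^ ((1 : ℝ) / 2) : ℝ) : ℂ) * (((q ^ (-ν) : ℝ) : ℂ) + ((q ^ ν : ℝ) : ℂ))
      = ((q ^ (ν + 1 / 2) : ℝ) : ℂ) + ((q ^ (-ν + 1 / 2) : ℝ) : ℂ) := by exact_mod_cast hs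
  have habC : ((q ^ (ν + 1 / 2) : ℝ) : ℂ) * ((q ^ (-ν + 1 / 2) : ℝ) : ℂ) = q := by exact_mod_cast hab
  rw [hsC]
  have T := (((Hu.mul_left ((1 - (q : ℂ) ^ 2) * z / 2)).add (H0.mul_left (q : ℂ))).sub
    (H1.mul_left (((q ^ (ν + 1 / 2) : ℝ) : ℂ) + ((q ^ (-ν + 1 / 2) : ℝ) : ℂ)))).add H2
  have Z : HasSum (fun _ : ℕ => (0 : ℂ)) 0 := hasSum_zero
  have key := T.unique (Z.congr_fun ?_)
  · rw [← key]
    field_simp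
    ring
  · intro k
    have hD : (1 - (q : ℂ) ^ (2 * k + 2)) ≠ 0 := by exact_mod_cast (aux_sq_lt hq0 hq1 k).ne'
    have hE : (1 - (q : ℂ) ^ 2) ≠ 0 := by exact_mod_cast h3.ne'
    rw [aux_rec hq0 hq1]
    push_cast
    have e1 : (q : ℂ) ^ (2 * k + 2) = ((q : ℂ) ^ k) ^ 2 * (q : ℂ) ^ 2 := by ring
    rw [e1] at hD ⊢
    have hQ : (q : ℂ) ^ k ≠ 0 := pow_ne_zero _ hqC
    have hX : z ^ k ≠ 0 := pow_ne_zero _ hzne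
    generalize ((q ^ (ν + 1 / 2) : ℝ) : ℂ) = a at *
    generalize ((q ^ (-ν + 1 / 2) : ℝ) : ℂ) = b at *
    generalize (phiCoef q ν k : ℂ) = c
    simp only [pow_succ _ k, mul_inv, inv_inv, mul_pow, inv_pow]
    generalize (q : ℂ) ^ k = Q at *
    generalize z ^ k = X at *
    generalize (q : ℂ) = p at *
    clear T Hu H0 H1 H2 H Z e1
    obtain ⟨D, hDe⟩ : ∃ D, D = 1 - Q ^ 2 * p ^ 2 := ⟨_, rfl⟩
    rw [← hDe] at hD ⊢
    field_simp
    rw [hDe]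
    subst habC
    ring
end

section
/- Let 0 < q < 1 be real, let ν be real, and let u be a complex number with |u| < q. Then the basic hypergeometric functions F(x) = ₂Φ₁(q^{ν+1/2}, q^{−ν+1/2}; −q; q, x) satisfy the exact quadratic ('q-Wronskian') identity (u/q + 1)·F(u)·F(−u/q) − (u/q − 1)·F(−u)·F(u/q) = 2. -/
/-- `F(x) = ₂Φ₁(q^{ν+1/2}, q^{-ν+1/2}; -q; q, x)`. -/
noncomputable def F19 (q ν : ℝ) (x : ℂ) : ℂ :=
  basicHyp21 ((q ^ (ν + 1 / 2) : ℝ) : ℂ) ((q ^ (-ν + 1 / 2) : ℝ) : ℂ) (-(q : ℂ)) (q : ℂ) x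

open Filter Topology in
lemma aux_summable_s19 (q s : ℂ) (hq : ‖q‖ < 1) (c : ℕ → ℂ)
    (hne : ∀ n : ℕ, 1 - q ^ (2 * n + 2) ≠ 0)
    (hc : ∀ n, c (n + 1) * (1 - q ^ (2 * n + 2)) = c n * (1 - s * q ^ n + q * q ^ (2 * n)))
    (x : ℂ) (hx : ‖x‖ < 1) : Summable (fun n => c n * x ^ n) := by
  obtain ⟨r, hr1, hr2⟩ := exists_between hx
  have h0 : Tendsto (fun n : ℕ => q ^ n) atTop (𝓝 0) := tendsto_pow_atTop_nhds_zero_of_norm_lt_one hq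
  have hT : Tendsto (fun n : ℕ => ‖(1 - s * q ^ n + q * (q ^ n * q ^ n)) / (1 - q ^ n * q ^ n * q ^ 2) * x‖)
      atTop (𝓝 ‖(1 - s * 0 + q * (0 * 0)) / (1 - 0 * 0 * q ^ 2) * x‖) := by
    refine Tendsto.norm (Tendsto.mul_const _ (Tendsto.div ?_ ?_ (by simp)))
    · exact (tendsto_const_nhds.sub (h0.const_mul s)).add ((h0.mul h0).const_mul q)
    · exact tendsto_const_nhds.sub ((h0.mul h0).mul_const _)
  have hT' : ‖(1 - s * 0 + q * (0 * 0)) / (1 - 0 * 0 * q ^ 2) * x‖ = ‖x‖ := by simp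
  rw [hT'] at hT
  refine summable_of_ratio_norm_eventually_le hr2 ?_
  filter_upwards [hT.eventually_lt_const hr1] with n hn
  have e : c (n + 1) * x ^ (n + 1)
      = ((1 - s * q ^ n + q * (q ^ n * q ^ n)) / (1 - q ^ n * q ^ n * q ^ 2) * x) * (c n * x ^ n) := by
    have e1 : q ^ n * q ^ n * q ^ 2 = q ^ (2 * n + 2) := by ring
    have e2 : q ^ n * q ^ n = q ^ (2 * n) := by ring
    rw [e1, e2]
    have h3 : c (n + 1) = c n * (1 - s * q ^ n + q * q ^ (2 * n)) / (1 - q ^ (2 * n + 2)) :=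
      (eq_div_iff (hne n)).2 (hc n)
    rw [h3]; ring
  rw [e, norm_mul]
  exact mul_le_mul_of_nonneg_right hn.le (norm_nonneg _)

lemma aux_fe (q s : ℂ) (hq : ‖q‖ < 1) (c : ℕ → ℂ)
    (hne : ∀ n : ℕ, 1 - q ^ (2 * n + 2) ≠ 0)
    (hc : ∀ n, c (n + 1) * (1 - q ^ (2 * n + 2)) = c n * (1 - s * q ^ n + q * q ^ (2 * n)))
    (G : ℂ → ℂ) (hG : ∀ x, G x = ∑' n, c n * x ^ n)
    (x : ℂ) (hx : ‖x‖ < 1) :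
    (1 - x) * G x = (1 + q * x) * G (q * (q * x)) - x * s * G (q * x) := by
  have hS := aux_summable_s19 q s hq c hne hc
  have hm : ∀ y : ℂ, ‖y‖ < 1 → ‖q * y‖ < 1 := fun y hy => by
    rw [norm_mul]; exact mul_lt_one_of_nonneg_of_lt_one_left (norm_nonneg _) hq hy.le
  have H : ∀ y : ℂ, ‖y‖ < 1 → HasSum (fun n => c n * y ^ n) (G y) := fun y hy => by
    rw [hG]; exact (hS y hy).hasSum
  have h0 := H x hx
  have h1 := H _ (hm x hx)
  have h2 := H _ (hm _ (hm x hx))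
  have A := h0.sub h2
  rw [← hasSum_nat_add_iff' 1] at A
  have B := ((h0.sub (h1.mul_left s)).add (h2.mul_left q)).mul_left x
  have E := A.unique (by
    refine Eq.mp (congrArg (fun f : ℕ → ℂ => HasSum f _) (funext fun n => ?_)) B
    have := hc n
    have e1 : (q * x) ^ n = q ^ n * x ^ n := by ring
    have e2 : (q * (q * x)) ^ n = q ^ (2 * n) * x ^ n := by ring
    have e3 : (q * (q * x)) ^ (n + 1) = q ^ (2 * n + 2) * x ^ (n + 1) := by ring
    simp only [e1, e2, e3]
    linear_combination -x ^ (n + 1) * this)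
  simp at E
  linear_combination E

open Filter Topology in
lemma aux_main (q s : ℂ) (hq : ‖q‖ < 1) (c : ℕ → ℂ) (hc0 : c 0 = 1)
    (hne : ∀ n : ℕ, 1 - q ^ (2 * n + 2) ≠ 0)
    (hc : ∀ n, c (n + 1) * (1 - q ^ (2 * n + 2)) = c n * (1 - s * q ^ n + q * q ^ (2 * n)))
    (G : ℂ → ℂ) (hG : ∀ x, G x = ∑' n, c n * x ^ n)
    (v : ℂ) (hv : ‖v‖ < 1) :
    (1 + v) * G (q * v) * G (-v) + (1 - v) * G (-(q * v)) * G v = 2 := by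
  have hS := aux_summable_s19 q s hq c hne hc
  have hF := aux_fe q s hq c hne hc G hG
  have hpow : Tendsto (fun n : ℕ => q ^ n) atTop (𝓝 0) := tendsto_pow_atTop_nhds_zero_of_norm_lt_one hq
  have step : ∀ n : ℕ, (1 + q ^ n * v) * G (q * (q ^ n * v)) * G (-(q ^ n * v))
      + (1 - q ^ n * v) * G (-(q * (q ^ n * v))) * G (q ^ n * v)
      = (1 + v) * G (q * v) * G (-v) + (1 - v) * G (-(q * v)) * G v := by
    intro n
    induction n with
    | zero => simp
    | succ n ih =>
      rw [← ih]
      have hw : ‖q ^ n * v‖ < 1 := by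
        rw [norm_mul, norm_pow]
        exact mul_lt_one_of_nonneg_of_lt_one_right (pow_le_one₀ (norm_nonneg _) hq.le) (norm_nonneg _) hv
      have e : q ^ (n + 1) * v = q * (q ^ n * v) := by ring
      rw [e]
      generalize q ^ n * v = w at hw
      have h1 := hF w hw
      have h2 := hF (-w) (by simpa using hw)
      simp only [mul_neg] at h2
      linear_combination -G (-(q * w)) * h1 - G (q * w) * h2
  have hG0 : G 0 = 1 := by
    rw [hG, tsum_eq_single 0 (fun n hn => by simp [hn])]; simp [hc0]
  have hcont : ∀ (y : ℕ → ℂ), Tendsto y atTop (𝓝 0) → (∀ n, ‖y n‖ ≤ ‖v‖) →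
      Tendsto (fun n => G (y n)) atTop (𝓝 1) := by
    intro y hy hb
    rw [← hG0]
    simp only [hG]
    refine tendsto_tsum_of_dominated_convergence (bound := fun k => ‖c k * v ^ k‖) (hS v hv).norm ?_ ?_
    · intro k
      exact (hy.pow k).const_mul _
    · refine Eventually.of_forall fun n k => ?_
      rw [norm_mul, norm_mul, norm_pow, norm_pow]
      gcongr
      exact hb n
  have hb1 : ∀ n : ℕ, ‖q ^ n * v‖ ≤ ‖v‖ := fun n => by
    rw [norm_mul, norm_pow]
    exact mul_le_of_le_one_left (norm_nonneg _) (pow_le_one₀ (norm_nonneg _) hq.le)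
  have hb2 : ∀ n : ℕ, ‖q * (q ^ n * v)‖ ≤ ‖v‖ := fun n => by
    rw [← mul_assoc, ← pow_succ']; exact hb1 _
  have t1 : Tendsto (fun n : ℕ => q ^ n * v) atTop (𝓝 0) := by simpa using hpow.mul_const v
  have t2 : Tendsto (fun n : ℕ => q * (q ^ n * v)) atTop (𝓝 0) := by simpa using t1.const_mul q
  have t1n : Tendsto (fun n : ℕ => -(q ^ n * v)) atTop (𝓝 0) := by simpa using t1.neg
  have t2n : Tendsto (fun n : ℕ => -(q * (q ^ n * v))) atTop (𝓝 0) := by simpa using t2.neg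
  have T := (((t1.const_add 1).mul (hcont _ t2 hb2)).mul (hcont _ t1n (by simpa using hb1))).add
    (((t1.const_sub 1).mul (hcont _ t2n (by simpa using hb2))).mul (hcont _ t1 hb1))
  simp only [step] at T
  rw [tendsto_nhds_unique tendsto_const_nhds T]
  norm_num

/-- The exact quadratic ("q-Wronskian") identity: for `|u| < q`,
`(u/q + 1) F(u) F(-u/q) - (u/q - 1) F(-u) F(u/q) = 2`. -/
theorem stmt19 (q : ℝ) (hq0 : 0 < q) (hq1 : q < 1) (ν : ℝ) (u : ℂ) (hu : ‖u‖ < q) :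
    (u / (q : ℂ) + 1) * F19 q ν u * F19 q ν (-u / (q : ℂ))
      - (u / (q : ℂ) - 1) * F19 q ν (-u) * F19 q ν (u / (q : ℂ)) = 2 := by
  have hqc : (q : ℂ) ≠ 0 := by exact_mod_cast hq0.ne'
  have hqn : ‖(q : ℂ)‖ < 1 := by simpa [abs_of_pos hq0] using hq1
  have hv : ‖u / (q : ℂ)‖ < 1 := by
    rw [norm_div, Complex.norm_real, Real.norm_of_nonneg hq0.le]
    exact (div_lt_one hq0).2 hu
  have hab : ((q ^ (ν + 1 / 2) : ℝ) : ℂ) * ((q ^ (-ν + 1 / 2) : ℝ) : ℂ) = q := by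
    rw [← Complex.ofReal_mul, ← Real.rpow_add hq0]
    have e : ν + 1 / 2 + (-ν + 1 / 2) = 1 := by ring
    rw [e, Real.rpow_one]
  set a : ℂ := ((q ^ (ν + 1 / 2) : ℝ) : ℂ) with ha
  set b : ℂ := ((q ^ (-ν + 1 / 2) : ℝ) : ℂ) with hb
  have n1 : ∀ n : ℕ, (1 - (q : ℂ) * (q : ℂ) ^ n) ≠ 0 := fun n => by
    rw [← pow_succ', ← Complex.ofReal_pow]
    have : q ^ (n + 1) < 1 := pow_lt_one₀ hq0.le hq1 (by simp)
    exact_mod_cast (sub_pos.2 this).ne'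
  have n2 : ∀ n : ℕ, (1 - (-(q : ℂ)) * (q : ℂ) ^ n) ≠ 0 := fun n => by
    have e : (1 - (-(q : ℂ)) * (q : ℂ) ^ n) = ((1 + q * q ^ n : ℝ) : ℂ) := by push_cast; ring
    rw [e]
    have : 0 < 1 + q * q ^ n := by positivity
    exact_mod_cast this.ne'
  have e12 : ∀ n : ℕ, 1 - (q : ℂ) ^ (2 * n + 2)
      = (1 - (q : ℂ) * (q : ℂ) ^ n) * (1 - (-(q : ℂ)) * (q : ℂ) ^ n) := fun n => by ring
  have key := aux_main (q : ℂ) (a + b) hqn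
    (fun n => qPochC a q n * qPochC b q n / (qPochC q q n * qPochC (-q) q n))
    (by simp [qPochC])
    (fun n => by rw [e12]; exact mul_ne_zero (n1 n) (n2 n))
    (fun n => by
      have p1 : qPochC q q n ≠ 0 := Finset.prod_ne_zero_iff.2 fun j _ => n1 j
      have p2 : qPochC (-q) q n ≠ 0 := Finset.prod_ne_zero_iff.2 fun j _ => n2 j
      have hs : ∀ z : ℂ, qPochC z q (n + 1) = qPochC z q n * (1 - z * (q : ℂ) ^ n) := fun z =>
        Finset.prod_range_succ _ _
      have e3 : 1 - (a + b) * (q : ℂ) ^ n + q * (q : ℂ) ^ (2 * n)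
          = (1 - a * (q : ℂ) ^ n) * (1 - b * (q : ℂ) ^ n) := by
        linear_combination -(q : ℂ) ^ (2 * n) * hab
      have m1 := n1 n
      have m2 := n2 n
      simp only [hs]
      rw [e12, e3, div_mul_eq_mul_div, div_mul_eq_mul_div, div_eq_div_iff
        (mul_ne_zero (mul_ne_zero p1 m1) (mul_ne_zero p2 m2)) (mul_ne_zero p1 p2)]
      ring)
    (F19 q ν) (fun x => rfl) (u / q) hv
  rw [mul_div_cancel₀ _ hqc] at key
  rw [neg_div]
  linear_combination key
end
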